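/- Let p, q be positive reals and let f : ℝ → ℝ be a nonnegative measurable function. Then ∫₀^∞ ∫₀^∞ (x^(3/2)/(y^(1/2)·(x+y)^(1/2))) · f(xy/(x+y)) · exp(-p·x - q·y) dx dy = (2/p^(3/2)) · ∫₀^∞ f(t) · t^(1/2) · exp(-(p+q)·t) · (√p·t·(p+q)·K₀(2·√p·√q·t) + √q·(2·p·t+1)·K₁(2·√p·√q·t)) dt. -/

import Mathlib

open MeasureTheory Real

/-- Modified Bessel function of the second kind, via its integral representation
`K_ν(z) = ∫₀^∞ exp(-z cosh u) cosh (ν u) du`. -/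
noncomputable def besselK (ν : ℝ) (z : ℝ) : ℝ :=
  ∫ u in Set.Ioi (0:ℝ), Real.exp (-z * Real.cosh u) * Real.cosh (ν * u)

lemma aux_scale (G : ℝ → ENNReal) (c : ℝ) (hc : 0 < c) :
    ∫⁻ y in Set.Ioi (0:ℝ), G y = ∫⁻ s in Set.Ioi (0:ℝ), ENNReal.ofReal c * G (c * s) := by
  have h := lintegral_image_eq_lintegral_abs_deriv_mul (s := Set.Ioi (0:ℝ))
    (f := fun s => c * s) (f' := fun _ => c) measurableSet_Ioi
    (fun x _ => by simpa using ((hasDerivAt_id x).const_mul c).hasDerivWithinAt)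
    (fun x _ y _ hxy => by simpa [hc.ne'] using hxy) G
  have himg : (fun s => c * s) '' Set.Ioi (0:ℝ) = Set.Ioi 0 := by
    ext y
    constructor
    · rintro ⟨s, hs, rfl⟩
      exact mul_pos hc hs
    · intro hy
      exact ⟨y / c, div_pos hy hc, by field_simp⟩
  rw [himg, abs_of_pos hc] at h
  exact h

lemma aux_exp (G : ℝ → ENNReal) (c : ℝ) (hc : 0 < c) :
    ∫⁻ y in Set.Ioi (0:ℝ), G y = ∫⁻ u, ENNReal.ofReal (c * exp u) * G (c * exp u) := by
  have h := lintegral_image_eq_lintegral_abs_deriv_mul (s := Set.univ)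
    (f := fun s => c * exp s) (f' := fun s => c * exp s) MeasurableSet.univ
    (fun x _ => ((Real.hasDerivAt_exp x).const_mul c).hasDerivWithinAt)
    (fun x _ y _ hxy => by simpa [hc.ne'] using hxy) G
  have himg : (fun s => c * exp s) '' Set.univ = Set.Ioi 0 := by
    ext y
    constructor
    · rintro ⟨s, hs, rfl⟩
      exact mul_pos hc (exp_pos s)
    · intro hy
      refine ⟨log (y / c), trivial, ?_⟩
      simp only
      rw [exp_log (div_pos hy hc)]
      field_simp
  rw [himg, setLIntegral_univ] at h
  rw [h]
  refine lintegral_congr fun u => ?_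
  rw [abs_of_pos (mul_pos hc (exp_pos u))]

lemma aux_split (G : ℝ → ENNReal) (hG : Measurable G) :
    ∫⁻ u, G u = ∫⁻ u in Set.Ioi (0:ℝ), (G u + G (-u)) := by
  have h := lintegral_image_eq_lintegral_abs_deriv_mul (s := Set.Ioi (0:ℝ))
    (f := fun s => -s) (f' := fun _ => -1) measurableSet_Ioi
    (fun x _ => (hasDerivAt_neg x).hasDerivWithinAt)
    (fun x _ y _ hxy => by simpa using hxy) G
  have himg : (fun s => -s) '' Set.Ioi (0:ℝ) = Set.Iio 0 := by simp
  rw [himg] at h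
  simp only [abs_neg, abs_one, ENNReal.ofReal_one, one_mul] at h
  rw [lintegral_add_left hG, ← h, ← lintegral_add_compl G (measurableSet_Ioi (a := (0:ℝ))),
    Set.compl_Ioi, setLIntegral_congr Iio_ae_eq_Iic]

lemma aux_int (z : ℝ) (hz : 0 < z) (ν : ℝ) (h0 : 0 ≤ ν) (hν : ν ≤ 2) :
    IntegrableOn (fun u => exp (-z * cosh u) * cosh (ν * u)) (Set.Ioi (0:ℝ)) := by
  have hb : IntegrableOn (fun u => exp (9 / z) * exp (-u)) (Set.Ioi (0:ℝ)) :=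
    (integrableOn_exp_neg_Ioi 0).const_mul _
  refine Integrable.mono' hb (by fun_prop) ?_
  refine (ae_restrict_iff' measurableSet_Ioi).2 (Filter.Eventually.of_forall fun u hu => ?_)
  have hu : 0 < u := hu
  rw [norm_of_nonneg (mul_nonneg (exp_pos _).le (cosh_pos _).le)]
  have h1 : cosh (ν * u) ≤ exp (2 * u) := by
    have : cosh (ν * u) ≤ cosh (2 * u) := by
      rw [cosh_le_cosh, abs_of_nonneg (by positivity), abs_of_nonneg (by positivity)]
      gcongr
    refine this.trans ?_
    rw [cosh_eq]
    have : exp (-(2 * u)) ≤ exp (2 * u) := exp_le_exp.2 (by linarith)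
    linarith
  have h2 : u ^ 2 / 4 ≤ cosh u := by
    rw [cosh_eq]
    have := quadratic_le_exp_of_nonneg hu.le
    have := exp_pos (-u)
    nlinarith
  calc exp (-z * cosh u) * cosh (ν * u) ≤ exp (-z * cosh u) * exp (2 * u) := by gcongr
    _ = exp (-z * cosh u + 2 * u) := by rw [exp_add]
    _ ≤ exp (9 / z + -u) := by
      apply exp_le_exp.2
      have : z * (u ^ 2 / 4) ≤ z * cosh u := by gcongr
      have h3 : 0 ≤ (z * u / 2 - 3) ^ 2 / z := by positivity
      have h4 : (z * u / 2 - 3) ^ 2 / z = z * (u ^ 2 / 4) - 3 * u + 9 / z := by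
        field_simp
        ring
      linarith
    _ = _ := by rw [exp_add]

lemma aux_rec (z : ℝ) (hz : 0 < z) :
    z * (besselK 2 z - besselK 0 z) = 2 * besselK 1 z := by
  have i0 := aux_int z hz 0 le_rfl (by norm_num)
  have i1 := aux_int z hz 1 (by norm_num) (by norm_num)
  have i2 := aux_int z hz 2 (by norm_num) (by norm_num)
  have hd : ∀ u : ℝ, HasDerivAt (fun u => exp (-z * cosh u) * sinh u)
      (exp (-z * cosh u) * cosh (1 * u) - z / 2 * (exp (-z * cosh u) * cosh (2 * u)
        - exp (-z * cosh u) * cosh (0 * u))) u := by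
    intro u
    have := (((Real.hasDerivAt_cosh u).const_mul (-z)).exp).mul (Real.hasDerivAt_sinh u)
    refine this.congr_deriv ?_
    rw [cosh_two_mul, one_mul, zero_mul, cosh_zero]
    have := cosh_sq u
    rw [this]
    ring
  have hi := i1.sub ((i2.sub i0).const_mul (z / 2))
  have hs : IntegrableOn (fun u => exp (-z * cosh u) * sinh u) (Set.Ioi (0:ℝ)) := by
    refine Integrable.mono' i1 (by fun_prop) (Filter.Eventually.of_forall fun u => ?_)
    rw [norm_mul, norm_of_nonneg (exp_pos _).le, one_mul]
    gcongr
    rw [Real.norm_eq_abs, abs_le]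
    constructor
    · rw [cosh_eq, sinh_eq]
      have := exp_pos u
      linarith
    · exact (sinh_lt_cosh u).le
  have ht := tendsto_zero_of_hasDerivAt_of_integrableOn_Ioi (fun u _ => hd u) hi hs
  have := integral_Ioi_of_hasDerivAt_of_tendsto' (a := 0) (fun u _ => hd u) hi ht
  have k := integral_sub i1 ((i2.sub i0).const_mul (z / 2))
  simp only [Pi.sub_apply] at k
  rw [k, integral_const_mul, integral_sub i2 i0] at this
  simp only [sinh_zero, mul_zero, sub_zero] at this
  unfold besselK
  linarith

lemma aux_core (p q t : ℝ) (hp : 0 < p) (hq : 0 < q) (ht : 0 < t) :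
    ∫⁻ s in Set.Ioi (0:ℝ), ENNReal.ofReal ((1 + s) ^ 2 / s ^ 3 * exp (-(t * (p / s + q * s))))
    = ENNReal.ofReal (2 / (t * p ^ ((3:ℝ)/2)) *
      (Real.sqrt p * t * (p + q) * besselK 0 (2 * Real.sqrt p * Real.sqrt q * t) +
           Real.sqrt q * (2 * p * t + 1) * besselK 1 (2 * Real.sqrt p * Real.sqrt q * t))) := by
  have hp32 : p ^ ((3:ℝ)/2) = √p ^ 3 := by
    rw [sqrt_eq_rpow, ← rpow_natCast, ← rpow_mul hp.le]
    norm_num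
  rw [hp32]
  obtain ⟨P, hP, rfl⟩ : ∃ P : ℝ, 0 < P ∧ p = P ^ 2 := ⟨√p, sqrt_pos.2 hp, (sq_sqrt hp.le).symm⟩
  obtain ⟨Q, hQ, rfl⟩ : ∃ Q : ℝ, 0 < Q ∧ q = Q ^ 2 := ⟨√q, sqrt_pos.2 hq, (sq_sqrt hq.le).symm⟩
  rw [sqrt_sq hP.le, sqrt_sq hQ.le]
  set z := 2 * P * Q * t with hz
  have hz0 : 0 < z := by positivity
  have i0 := aux_int z hz0 0 le_rfl (by norm_num)
  have i1 := aux_int z hz0 1 (by norm_num) (by norm_num)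
  have i2 := aux_int z hz0 2 (by norm_num) (by norm_num)
  rw [aux_exp _ (P / Q) (by positivity)]
  have e1 : ∀ u : ℝ, ENNReal.ofReal (P / Q * exp u) * ENNReal.ofReal ((1 + P / Q * exp u) ^ 2 /
      (P / Q * exp u) ^ 3 * exp (-(t * (P ^ 2 / (P / Q * exp u) + Q ^ 2 * (P / Q * exp u)))))
      = ENNReal.ofReal (((Q / P) ^ 2 * exp (-(2 * u)) + 2 * (Q / P) * exp (-u) + 1)
        * exp (-z * cosh u)) := by
    intro u
    rw [← ENNReal.ofReal_mul (by positivity)]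
    congr 1
    have h1 : -(t * (P ^ 2 / (P / Q * exp u) + Q ^ 2 * (P / Q * exp u))) = -z * cosh u := by
      rw [cosh_eq, exp_neg, hz]
      field_simp
      ring
    rw [h1, ← mul_assoc]
    congr 1
    rw [exp_neg, exp_neg, two_mul u, exp_add]
    field_simp
    ring
  rw [lintegral_congr e1, aux_split _ (by fun_prop)]
  have e2 : ∀ u : ℝ, ENNReal.ofReal (((Q / P) ^ 2 * exp (-(2 * u)) + 2 * (Q / P) * exp (-u) + 1)
        * exp (-z * cosh u)) +
      ENNReal.ofReal (((Q / P) ^ 2 * exp (-(2 * -u)) + 2 * (Q / P) * exp (- -u) + 1)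
        * exp (-z * cosh (-u))) = ENNReal.ofReal (2 * (Q / P) ^ 2 *
          (exp (-z * cosh u) * cosh (2 * u)) + 4 * (Q / P) * (exp (-z * cosh u) * cosh (1 * u))
          + 2 * (exp (-z * cosh u) * cosh (0 * u))) := by
    intro u
    rw [← ENNReal.ofReal_add (by positivity) (by positivity)]
    congr 1
    rw [cosh_neg, zero_mul, cosh_zero, one_mul, cosh_eq (2 * u)]
    have : exp (-u) = 2 * cosh u - exp u := by rw [cosh_eq]; ring
    rw [this]
    simp only [mul_neg, neg_neg]
    ring
  have hI : IntegrableOn (fun u => 2 * (Q / P) ^ 2 *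
          (exp (-z * cosh u) * cosh (2 * u)) + 4 * (Q / P) * (exp (-z * cosh u) * cosh (1 * u))
          + 2 * (exp (-z * cosh u) * cosh (0 * u))) (Set.Ioi (0:ℝ)) :=
    ((i2.const_mul _).add (i1.const_mul _)).add (i0.const_mul _)
  rw [lintegral_congr e2, ← ofReal_integral_eq_lintegral_ofReal hI
    (Filter.Eventually.of_forall fun u => by
      have := cosh_pos (2 * u)
      have := cosh_pos (1 * u)
      have := cosh_pos (0 * u)
      simp only [Pi.zero_apply]
      positivity)]
  congr 1
  have j1 := integral_add ((i2.const_mul (2 * (Q / P) ^ 2)).add (i1.const_mul (4 * (Q / P))))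
    (i0.const_mul 2)
  have j2 := integral_add (i2.const_mul (2 * (Q / P) ^ 2)) (i1.const_mul (4 * (Q / P)))
  simp only [Pi.add_apply] at j1
  rw [j1, j2, integral_const_mul, integral_const_mul, integral_const_mul]
  have hr := aux_rec z hz0
  change 2 * (Q / P) ^ 2 * besselK 2 z + 4 * (Q / P) * besselK 1 z + 2 * besselK 0 z = _
  have h2 : besselK 2 z = besselK 0 z + besselK 1 z / (P * Q * t) := by
    rw [hz] at hr ⊢
    field_simp
    linarith
  rw [h2]
  field_simp
  ring

theorem stmt_11 (p q : ℝ) (hp : 0 < p) (hq : 0 < q) (f : ℝ → ℝ)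
    (hf : Measurable f) (hf0 : ∀ t, 0 ≤ f t) :
    (∫⁻ x in Set.Ioi (0:ℝ), ∫⁻ y in Set.Ioi (0:ℝ),
        ENNReal.ofReal ((x ^ ((3:ℝ)/2) / (y ^ ((1:ℝ)/2) * (x + y) ^ ((1:ℝ)/2))) *
          f (x * y / (x + y)) * Real.exp (-p * x - q * y)))
    = ENNReal.ofReal (2 / p ^ ((3:ℝ)/2)) *
      ∫⁻ t in Set.Ioi (0:ℝ),
        ENNReal.ofReal (f t * t ^ ((1:ℝ)/2) * Real.exp (-(p + q) * t) *
          (Real.sqrt p * t * (p + q) * besselK 0 (2 * Real.sqrt p * Real.sqrt q * t) +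
           Real.sqrt q * (2 * p * t + 1) * besselK 1 (2 * Real.sqrt p * Real.sqrt q * t))) := by
  set F : ℝ → ℝ → ENNReal := fun x y =>
    ENNReal.ofReal ((x ^ ((3:ℝ)/2) / (y ^ ((1:ℝ)/2) * (x + y) ^ ((1:ℝ)/2))) *
          f (x * y / (x + y)) * Real.exp (-p * x - q * y)) with hF
  have hFm : Measurable (Function.uncurry F) := by
    simp only [hF, Function.uncurry_def]
    fun_prop
  have s1 : ∫⁻ x in Set.Ioi (0:ℝ), ∫⁻ y in Set.Ioi (0:ℝ), F x y
      = ∫⁻ x in Set.Ioi (0:ℝ), ∫⁻ s in Set.Ioi (0:ℝ), ENNReal.ofReal x * F x (x * s) :=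
    setLIntegral_congr_fun measurableSet_Ioi fun x hx => aux_scale _ x hx
  have s2 : ∫⁻ x in Set.Ioi (0:ℝ), ∫⁻ s in Set.Ioi (0:ℝ), ENNReal.ofReal x * F x (x * s)
      = ∫⁻ s in Set.Ioi (0:ℝ), ∫⁻ x in Set.Ioi (0:ℝ), ENNReal.ofReal x * F x (x * s) := by
    refine lintegral_lintegral_swap (Measurable.aemeasurable ?_)
    simp only [hF, Function.uncurry_def]
    fun_prop
  set H : ℝ → ℝ → ENNReal := fun s t =>
    ENNReal.ofReal (f t * t ^ ((1:ℝ)/2) * Real.exp (-(p + q) * t) * t) *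
      ENNReal.ofReal ((1 + s) ^ 2 / s ^ 3 * exp (-(t * (p / s + q * s)))) with hH
  have s3 : ∫⁻ s in Set.Ioi (0:ℝ), ∫⁻ x in Set.Ioi (0:ℝ), ENNReal.ofReal x * F x (x * s)
      = ∫⁻ s in Set.Ioi (0:ℝ), ∫⁻ t in Set.Ioi (0:ℝ), H s t := by
    refine setLIntegral_congr_fun measurableSet_Ioi fun s hs => ?_
    have hs : 0 < s := hs
    rw [aux_scale _ ((1 + s) / s) (by positivity)]
    refine setLIntegral_congr_fun measurableSet_Ioi fun t ht => ?_
    have ht : 0 < t := ht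
    simp only [hF, hH]
    have := hf0 t
    rw [← ENNReal.ofReal_mul (by positivity), ← ENNReal.ofReal_mul (by positivity),
      ← ENNReal.ofReal_mul (by positivity)]
    congr 1
    have a1 : (1 + s) / s * t * ((1 + s) / s * t * s) / ((1 + s) / s * t + (1 + s) / s * t * s)
        = t := by
      field_simp
    have a2 : -p * ((1 + s) / s * t) - q * ((1 + s) / s * t * s)
        = -(p + q) * t + -(t * (p / s + q * s)) := by
      field_simp
      ring
    have a3 : ((1 + s) / s * t) ^ ((3:ℝ)/2) / (((1 + s) / s * t * s) ^ ((1:ℝ)/2) *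
        ((1 + s) / s * t + (1 + s) / s * t * s) ^ ((1:ℝ)/2)) = t ^ ((1:ℝ)/2) / s := by
      have b1 : (1 + s) / s * t * s = (1 + s) * t := by field_simp
      have b2 : (1 + s) / s * t + (1 + s) * t = ((1 + s) / s * t) * (1 + s) := by
        field_simp
      have b3 : ∀ x : ℝ, 0 < x → x ^ ((3:ℝ)/2) = x * x ^ ((1:ℝ)/2) := by
        intro x hx
        rw [show (3:ℝ)/2 = 1 + 1/2 by norm_num, rpow_add hx, rpow_one]
      rw [b1, b2, b3 _ (by positivity), mul_rpow (x := (1 + s) / s * t) (by positivity) (by positivity),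
        mul_rpow (x := 1 + s) (by positivity) (by positivity)]
      have c1 : (1 + s) ^ ((1:ℝ)/2) * (1 + s) ^ ((1:ℝ)/2) = 1 + s := by
        rw [← rpow_add (by positivity)]; norm_num
      have c2 : t ^ ((1:ℝ)/2) * t ^ ((1:ℝ)/2) = t := by
        rw [← rpow_add (by positivity)]; norm_num
      have d0 : 0 < ((1 + s) / s * t) ^ ((1:ℝ)/2) := by positivity
      have d1 : 0 < (1 + s) ^ ((1:ℝ)/2) := by positivity
      have d2 : 0 < t ^ ((1:ℝ)/2) := by positivity
      generalize ((1 + s) / s * t) ^ ((1:ℝ)/2) = A at *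
      generalize (1 + s) ^ ((1:ℝ)/2) = B at *
      generalize t ^ ((1:ℝ)/2) = C at *
      rw [div_eq_div_iff (by positivity) (by positivity)]
      have : (1 + s) / s * t * A * s = (1 + s) * t * A := by field_simp
      rw [this, ← c1, ← c2]
      ring
    rw [a1, a2, a3, exp_add]
    field_simp
  have s4 : ∫⁻ s in Set.Ioi (0:ℝ), ∫⁻ t in Set.Ioi (0:ℝ), H s t
      = ∫⁻ t in Set.Ioi (0:ℝ), ∫⁻ s in Set.Ioi (0:ℝ), H s t := by
    refine lintegral_lintegral_swap (Measurable.aemeasurable ?_)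
    simp only [hH, Function.uncurry_def]
    fun_prop
  rw [s1, s2, s3, s4, ← lintegral_const_mul' _ _ ENNReal.ofReal_ne_top]
  refine setLIntegral_congr_fun measurableSet_Ioi fun t ht => ?_
  have ht : 0 < t := ht
  have := hf0 t
  simp only [hH]
  rw [lintegral_const_mul' _ _ ENNReal.ofReal_ne_top, aux_core p q t hp hq ht,
    ← ENNReal.ofReal_mul (by positivity), ← ENNReal.ofReal_mul (by positivity)]
  congr 1
  field_simp
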